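/- arXiv:dg-ga/9703018 — 2 statements merged into one kernel-verified Lean document; each statement's English description precedes it below -/
import Mathlib

section
/- First variation identity for higher-order Lagrangians: for every smooth curve q : ℝ → ℝⁿ, every smooth map v : ℝ → ℝⁿ, and every t ∈ ℝ, one has Σ_{j=0}^{k} ⟨∂_j L(j_k q(t)), v^{(j)}(t)⟩ = ⟨E_q(t), v(t)⟩ + (d/dt)[ Σ_{j=0}^{k−1} ⟨p_q^{(j)}(s), v^{(j)}(s)⟩ ](t), where v^{(j)} denotes the j-th derivative of v. -/
open RealInnerProductSpace

noncomputable section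

/-- The model space ℝⁿ. -/
abbrev E (n : ℕ) := EuclideanSpace ℝ (Fin n)

/-- The `m`-jet of a curve `q : ℝ → ℝⁿ`:  `jet q m t = (q t, q' t, …, q⁽ᵐ⁾ t)`. -/
def jet {n : ℕ} (q : ℝ → E n) (m : ℕ) : ℝ → (Fin (m + 1) → E n) :=
  fun t i => iteratedDeriv i q t

/-- The partial gradient `∂_j L` of `L : (ℝⁿ)^{k+1} → ℝ` with respect to its `j`-th slot,
characterized by `⟪∂_j L x, v⟫ = DL x (0, …, v, …, 0)` (with `v` in slot `j`). -/
def pgrad {n k : ℕ} (L : (Fin (k + 1) → E n) → ℝ) (j : Fin (k + 1))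
    (x : Fin (k + 1) → E n) : E n :=
  gradient (fun v => L (Function.update x j v)) (x j)

/-- The Euler–Lagrange expression of `L` along the curve `q`:
`E_q t = ∑_{j=0}^{k} (−1)^j (d/dt)^j [∂_j L (j_k q s)] t`. -/
def EL {n k : ℕ} (L : (Fin (k + 1) → E n) → ℝ) (q : ℝ → E n) (t : ℝ) : E n :=
  ∑ j : Fin (k + 1),
    (-1 : ℝ) ^ (j : ℕ) • iteratedDeriv j (fun s => pgrad L j (jet q k s)) t

/-- `q` is a solution of the Euler–Lagrange equations of `L`. -/
def IsELSolution {n k : ℕ} (L : (Fin (k + 1) → E n) → ℝ) (q : ℝ → E n) : Prop :=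
  ∀ t : ℝ, EL L q t = 0

/-- The `j`-th Jacobi–Ostrogradski momentum along `q`:
`p_q^{(j)} t = ∑_{l=0}^{k−1−j} (−1)^l (d/dt)^l [∂_{j+l+1} L (j_k q s)] t`. -/
def mom {n k : ℕ} (L : (Fin (k + 1) → E n) → ℝ) (q : ℝ → E n) (j : Fin k) (t : ℝ) : E n :=
  ∑ l : Fin (k - (j : ℕ)),
    (-1 : ℝ) ^ (l : ℕ) •
      iteratedDeriv l
        (fun s => pgrad L ⟨(j : ℕ) + (l : ℕ) + 1, by
          have h1 := l.isLt; have h2 := j.isLt; omega⟩ (jet q k s)) t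

/-- The Hessian of `L` in its last slot, as a (continuous) linear map `ℝⁿ → ℝⁿ`:
`⟪H_L x u, v⟫ = D²L x ((0,…,0,u), (0,…,0,v))`. -/
def hessLast {n k : ℕ} (L : (Fin (k + 1) → E n) → ℝ) (x : Fin (k + 1) → E n) :
    E n →L[ℝ] E n :=
  fderiv ℝ (fun v => pgrad L (Fin.last k) (Function.update x (Fin.last k) v))
    (x (Fin.last k))

/-- `L` is regular if the Hessian in its last slot is invertible at every point. -/
def Regular {n k : ℕ} (L : (Fin (k + 1) → E n) → ℝ) : Prop :=
  ∀ x : Fin (k + 1) → E n, Function.Bijective (hessLast L x)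

/-- `G : (ℝⁿ)^{2k} → ℝ` is a constant of motion of `L`. -/
def IsConstantOfMotion {n k : ℕ} (L : (Fin (k + 1) → E n) → ℝ)
    (G : (Fin (2 * k - 1 + 1) → E n) → ℝ) : Prop :=
  ∀ q : ℝ → E n, ContDiff ℝ (⊤ : ℕ∞) q → IsELSolution L q →
    ∃ c : ℝ, ∀ t : ℝ, G (jet q (2 * k - 1) t) = c

/-- The partial gradient is the Riesz representative of the restriction of `DL x` to a slot. -/
theorem pgrad_eq_toDual_symm {n k : ℕ} {L : (Fin (k + 1) → E n) → ℝ} (j : Fin (k + 1))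
    {x : Fin (k + 1) → E n} (hL : DifferentiableAt ℝ L x) :
    pgrad L j x = (InnerProductSpace.toDual ℝ (E n)).symm
      ((fderiv ℝ L x).comp (ContinuousLinearMap.single ℝ (fun _ : Fin (k + 1) => E n) j)) := by
  have hL' : HasFDerivAt L (fderiv ℝ L x) (Function.update x j (x j)) := by
    rw [Function.update_eq_self]
    exact hL.hasFDerivAt
  have h := hL'.comp (x j) (hasFDerivAt_update x (x j))
  unfold pgrad gradient
  congr 1
  refine h.fderiv.trans ?_
  congr 1
  ext w i
  by_cases hij : i = j
  · subst hij
    simp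
  · simp [hij]

theorem contDiff_pgrad {n k : ℕ} {L : (Fin (k + 1) → E n) → ℝ}
    (hL : ContDiff ℝ (⊤ : ℕ∞) L) (j : Fin (k + 1)) : ContDiff ℝ (⊤ : ℕ∞) (pgrad L j) := by
  have hd : Differentiable ℝ L := hL.differentiable (by simp)
  rw [show pgrad L j = _ from funext fun x => pgrad_eq_toDual_symm j (hd x)]
  exact (InnerProductSpace.toDual ℝ (E n)).symm.contDiff.comp
    ((hL.fderiv_right (m := (⊤ : ℕ∞)) (by simp)).clm_comp contDiff_const)

theorem contDiff_iteratedDeriv {F : Type*} [NormedAddCommGroup F] [NormedSpace ℝ F] {f : ℝ → F}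
    (hf : ContDiff ℝ (⊤ : ℕ∞) f) (i : ℕ) : ContDiff ℝ (⊤ : ℕ∞) (iteratedDeriv i f) := by
  rw [iteratedDeriv_eq_iterate]
  exact hf.iterate_deriv i

theorem hasDerivAt_iteratedDeriv {F : Type*} [NormedAddCommGroup F] [NormedSpace ℝ F] {f : ℝ → F}
    (hf : ContDiff ℝ (⊤ : ℕ∞) f) (i : ℕ) (t : ℝ) :
    HasDerivAt (iteratedDeriv i f) (iteratedDeriv (i + 1) f t) t := by
  rw [iteratedDeriv_succ]
  exact ((contDiff_iteratedDeriv hf i).differentiable (by simp) t).hasDerivAt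

theorem contDiff_jet {n : ℕ} {q : ℝ → E n} (hq : ContDiff ℝ (⊤ : ℕ∞) q) (m : ℕ) :
    ContDiff ℝ (⊤ : ℕ∞) (jet q m) :=
  contDiff_pi.2 fun i => contDiff_iteratedDeriv hq i

/-- Repeated integration by parts for a finite family of smooth curves paired with the successive
derivatives of a smooth curve. -/
theorem hasDerivAt_sum_inner_iteratedDeriv {F : Type*} [NormedAddCommGroup F]
    [InnerProductSpace ℝ F] (k : ℕ) {f : ℕ → ℝ → F} (hf : ∀ j, ContDiff ℝ (⊤ : ℕ∞) (f j))
    {v : ℝ → F} (hv : ContDiff ℝ (⊤ : ℕ∞) v) (t : ℝ) :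
    HasDerivAt
      (fun s => ∑ j ∈ Finset.range k,
        ⟪∑ l ∈ Finset.range (k - j), (-1 : ℝ) ^ l • iteratedDeriv l (f (j + l + 1)) s,
          iteratedDeriv j v s⟫)
      (∑ j ∈ Finset.range (k + 1), ⟪f j t, iteratedDeriv j v t⟫ -
        ⟪∑ j ∈ Finset.range (k + 1), (-1 : ℝ) ^ j • iteratedDeriv j (f j) t, v t⟫) t := by
  set p : ℕ → ℝ → F := fun j s =>
    ∑ l ∈ Finset.range (k - j), (-1 : ℝ) ^ l • iteratedDeriv l (f (j + l + 1)) s with hp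
  set p' : ℕ → F := fun j =>
    ∑ l ∈ Finset.range (k - j), (-1 : ℝ) ^ l • iteratedDeriv (l + 1) (f (j + l + 1)) t with hp'
  have hderiv (j : ℕ) : HasDerivAt (p j) (p' j) t :=
    HasDerivAt.fun_sum fun l _ => (hasDerivAt_iteratedDeriv (hf _) l t).const_smul ((-1 : ℝ) ^ l)
  have hrec (j : ℕ) (hj : j < k) : p j t = f (j + 1) t - p' (j + 1) := by
    have hkj : k - j = k - (j + 1) + 1 := by omega
    simp only [hp, hp']
    rw [hkj, Finset.sum_range_succ', add_comm, sub_eq_add_neg, ← Finset.sum_neg_distrib]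
    congr 1
    · simp
    · refine Finset.sum_congr rfl fun l _ => ?_
      rw [show j + (l + 1) + 1 = j + 1 + l + 1 by ring, pow_succ]
      simp
  have hEL : ∑ j ∈ Finset.range (k + 1), (-1 : ℝ) ^ j • iteratedDeriv j (f j) t
      = f 0 t - p' 0 := by
    simp only [hp']
    rw [Finset.sum_range_succ', add_comm, sub_eq_add_neg, ← Finset.sum_neg_distrib]
    congr 1
    · simp
    · refine Finset.sum_congr (by simp) fun l _ => ?_
      simp [pow_succ]
  have hlast : p' k = 0 := by simp [hp']
  have hsum := HasDerivAt.fun_sum (u := Finset.range k) fun j _ =>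
    (hderiv j).inner ℝ (hasDerivAt_iteratedDeriv hv j t)
  refine hsum.congr_deriv ?_
  have htel := Finset.sum_range_sub (fun j => ⟪p' j, iteratedDeriv j v t⟫) k
  rw [hEL, Finset.sum_range_succ', inner_sub_left, iteratedDeriv_zero]
  simp only [hlast, inner_zero_left, iteratedDeriv_zero] at htel
  have hterm : ∑ j ∈ Finset.range k,
      (⟪p j t, iteratedDeriv (j + 1) v t⟫ + ⟪p' j, iteratedDeriv j v t⟫) =
      ∑ j ∈ Finset.range k, (⟪f (j + 1) t, iteratedDeriv (j + 1) v t⟫ -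
        (⟪p' (j + 1), iteratedDeriv (j + 1) v t⟫ - ⟪p' j, iteratedDeriv j v t⟫)) := by
    refine Finset.sum_congr rfl fun j hj => ?_
    rw [hrec j (Finset.mem_range.1 hj), inner_sub_left]
    ring
  rw [hterm, Finset.sum_sub_distrib, htel]
  ring

/-- **First variation identity for higher-order Lagrangians.**
For every smooth curve `q : ℝ → ℝⁿ`, every smooth map `v : ℝ → ℝⁿ` and every `t ∈ ℝ`,
`∑_{j=0}^{k} ⟪∂_j L (j_k q t), v⁽ʲ⁾ t⟫ = ⟪E_q t, v t⟫ + (d/dt)[∑_{j=0}^{k−1} ⟪p_q^{(j)} s, v⁽ʲ⁾ s⟫] t`. -/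
theorem first_variation_identity
    (n k : ℕ) (hn : 1 ≤ n) (hk : 1 ≤ k)
    (L : (Fin (k + 1) → E n) → ℝ) (hL : ContDiff ℝ (⊤ : ℕ∞) L)
    (q : ℝ → E n) (hq : ContDiff ℝ (⊤ : ℕ∞) q)
    (v : ℝ → E n) (hv : ContDiff ℝ (⊤ : ℕ∞) v) (t : ℝ) :
    ∑ j : Fin (k + 1), ⟪pgrad L j (jet q k t), iteratedDeriv j v t⟫ =
      ⟪EL L q t, v t⟫ +
        deriv (fun s => ∑ j : Fin k, ⟪mom L q j s, iteratedDeriv j v s⟫) t := by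
  set f : ℕ → ℝ → E n := fun j s =>
    if h : j < k + 1 then pgrad L ⟨j, h⟩ (jet q k s) else 0
  have hf_eq (j : ℕ) (h : j < k + 1) : f j = fun s => pgrad L ⟨j, h⟩ (jet q k s) :=
    funext fun s => dif_pos h
  have hf_smooth (j : ℕ) : ContDiff ℝ (⊤ : ℕ∞) (f j) := by
    by_cases h : j < k + 1
    · rw [hf_eq j h]
      exact (contDiff_pgrad hL _).comp (contDiff_jet hq k)
    · rw [show f j = fun _ => 0 from funext fun s => dif_neg h]
      exact contDiff_const
  have hmom (j : Fin k) (s : ℝ) : mom L q j s = ∑ l ∈ Finset.range (k - j),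
      (-1 : ℝ) ^ l • iteratedDeriv l (f (j + l + 1)) s := by
    rw [← Fin.sum_univ_eq_sum_range
      (fun l => (-1 : ℝ) ^ l • iteratedDeriv l (f (j + l + 1)) s)]
    exact Finset.sum_congr rfl fun l _ => by rw [hf_eq _ (by omega)]
  have hEL : EL L q t =
      ∑ j ∈ Finset.range (k + 1), (-1 : ℝ) ^ j • iteratedDeriv j (f j) t := by
    rw [← Fin.sum_univ_eq_sum_range (fun j => (-1 : ℝ) ^ j • iteratedDeriv j (f j) t)]
    exact Finset.sum_congr rfl fun j _ => by rw [hf_eq _ j.isLt]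
  have hlhs : ∑ j : Fin (k + 1), ⟪pgrad L j (jet q k t), iteratedDeriv j v t⟫ =
      ∑ j ∈ Finset.range (k + 1), ⟪f j t, iteratedDeriv j v t⟫ := by
    rw [← Fin.sum_univ_eq_sum_range (fun j => ⟪f j t, iteratedDeriv j v t⟫)]
    exact Finset.sum_congr rfl fun j _ => by rw [hf_eq _ j.isLt]
  have hboundary : (fun s => ∑ j : Fin k, ⟪mom L q j s, iteratedDeriv j v s⟫) = fun s =>
      ∑ j ∈ Finset.range k, ⟪∑ l ∈ Finset.range (k - j),
        (-1 : ℝ) ^ l • iteratedDeriv l (f (j + l + 1)) s, iteratedDeriv j v s⟫ := by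
    funext s
    rw [← Fin.sum_univ_eq_sum_range (fun j => ⟪∑ l ∈ Finset.range (k - j),
      (-1 : ℝ) ^ l • iteratedDeriv l (f (j + l + 1)) s, iteratedDeriv j v s⟫)]
    exact Finset.sum_congr rfl fun j _ => by rw [hmom]
  rw [hlhs, hEL, hboundary, (hasDerivAt_sum_inner_iteratedDeriv k hf_smooth hv t).deriv]
  ring
end
end

section
/- Linearity of the Euler–Lagrange expression in the highest derivative: there exists a smooth map R : (ℝⁿ)^{2k} → ℝⁿ such that for every smooth curve q : ℝ → ℝⁿ and every t ∈ ℝ, E_q(t) = (−1)^k H_L(j_k q(t)) (q^{(2k)}(t)) + R(j_{2k−1} q(t)), where for x ∈ (ℝⁿ)^{k+1}, H_L(x) : ℝⁿ → ℝⁿ is the linear map determined by the Hessian of L in its last slot, ⟨H_L(x) u, v⟩ = D²L(x)((0,…,0,u),(0,…,0,v)). -/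
open RealInnerProductSpace

noncomputable section

/-- A functional `Φ` of curves depends smoothly on the derivatives of order `< m`. -/
def IsJetFunctional {n : ℕ} {W : Type*} [NormedAddCommGroup W] [NormedSpace ℝ W] (m : ℕ)
    (Φ : (ℝ → E n) → ℝ → W) : Prop :=
  ∃ G : (Fin m → E n) → W, ContDiff ℝ (⊤ : ℕ∞) G ∧
    ∀ q : ℝ → E n, ContDiff ℝ (⊤ : ℕ∞) q → ∀ t : ℝ, Φ q t = G fun i => iteratedDeriv i q t

theorem hasDerivAt_iteratedDeriv_of_smooth {n : ℕ} {q : ℝ → E n}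
    (hq : ContDiff ℝ (⊤ : ℕ∞) q) (i : ℕ) (t : ℝ) :
    HasDerivAt (iteratedDeriv i q) (iteratedDeriv (i + 1) q t) t := by
  rw [iteratedDeriv_succ]
  exact (hq.differentiable_iteratedDeriv i (by exact_mod_cast ENat.natCast_lt_top i) t).hasDerivAt

theorem hasDerivAt_jet {n : ℕ} {q : ℝ → E n} (hq : ContDiff ℝ (⊤ : ℕ∞) q) (m : ℕ) (t : ℝ) :
    HasDerivAt (fun s (i : Fin m) => iteratedDeriv i q s)
      (fun i => iteratedDeriv (i + 1) q t) t :=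
  hasDerivAt_pi.2 fun i => hasDerivAt_iteratedDeriv_of_smooth hq i t

namespace IsJetFunctional

variable {n m : ℕ} {V W : Type*} [NormedAddCommGroup V] [NormedSpace ℝ V]
  [NormedAddCommGroup W] [NormedSpace ℝ W]

theorem mono {m' : ℕ} {Φ : (ℝ → E n) → ℝ → W} (h : IsJetFunctional m Φ) (hm : m ≤ m') :
    IsJetFunctional m' Φ := by
  obtain ⟨G, hG, hΦ⟩ := h
  exact ⟨fun x => G fun i => x (Fin.castLE hm i), by fun_prop, hΦ⟩

protected theorem congr {Φ Ψ : (ℝ → E n) → ℝ → W} (h : IsJetFunctional m Φ)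
    (hΨ : ∀ q, ContDiff ℝ (⊤ : ℕ∞) q → ∀ t, Ψ q t = Φ q t) : IsJetFunctional m Ψ := by
  obtain ⟨G, hG, hΦ⟩ := h
  exact ⟨G, hG, fun q hq t => (hΨ q hq t).trans (hΦ q hq t)⟩

theorem iteratedDeriv_self {i : ℕ} (hi : i < m) :
    IsJetFunctional m fun (q : ℝ → E n) t => iteratedDeriv i q t :=
  ⟨fun x => x ⟨i, hi⟩, by fun_prop, fun _ _ _ => rfl⟩

theorem add {Φ Ψ : (ℝ → E n) → ℝ → W} (hΦ : IsJetFunctional m Φ) (hΨ : IsJetFunctional m Ψ) :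
    IsJetFunctional m fun q t => Φ q t + Ψ q t := by
  obtain ⟨G, hG, hΦ⟩ := hΦ
  obtain ⟨K, hK, hΨ⟩ := hΨ
  exact ⟨fun x => G x + K x, hG.add hK, fun q hq t => by simp only [hΦ q hq, hΨ q hq]⟩

theorem const_smul (c : ℝ) {Φ : (ℝ → E n) → ℝ → W} (hΦ : IsJetFunctional m Φ) :
    IsJetFunctional m fun q t => c • Φ q t := by
  obtain ⟨G, hG, hΦ⟩ := hΦ
  exact ⟨fun x => c • G x, hG.const_smul c, fun q hq t => by simp only [hΦ q hq]⟩

protected theorem sum {ι : Type*} [Fintype ι] {Φ : ι → (ℝ → E n) → ℝ → W}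
    (hΦ : ∀ i, IsJetFunctional m (Φ i)) : IsJetFunctional m fun q t => ∑ i, Φ i q t := by
  choose G hG hΦ using hΦ
  exact ⟨fun x => ∑ i, G i x, ContDiff.sum fun i _ => hG i,
    fun q hq t => Finset.sum_congr rfl fun i _ => hΦ i q hq t⟩

theorem clm_apply {A : (ℝ → E n) → ℝ → V →L[ℝ] W} {Φ : (ℝ → E n) → ℝ → V}
    (hA : IsJetFunctional m A) (hΦ : IsJetFunctional m Φ) :
    IsJetFunctional m fun q t => A q t (Φ q t) := by
  obtain ⟨G, hG, hA⟩ := hA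
  obtain ⟨K, hK, hΦ⟩ := hΦ
  exact ⟨fun x => G x (K x), hG.clm_apply hK, fun q hq t => by simp only [hA q hq, hΦ q hq]⟩

theorem differentiable {Φ : (ℝ → E n) → ℝ → W} (hΦ : IsJetFunctional m Φ) {q : ℝ → E n}
    (hq : ContDiff ℝ (⊤ : ℕ∞) q) : Differentiable ℝ (Φ q) := by
  obtain ⟨G, hG, hΦ⟩ := hΦ
  rw [funext (hΦ q hq)]
  exact (hG.differentiable (by simp)).comp fun t => (hasDerivAt_jet hq m t).differentiableAt

protected theorem deriv {Φ : (ℝ → E n) → ℝ → W} (hΦ : IsJetFunctional m Φ) :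
    IsJetFunctional (m + 1) fun q => deriv (Φ q) := by
  obtain ⟨G, hG, hΦ⟩ := hΦ
  refine ⟨fun x => fderiv ℝ G (fun i => x i.castSucc) fun i => x i.succ, ?_, fun q hq t => ?_⟩
  · have hG' : ContDiff ℝ (⊤ : ℕ∞) (fderiv ℝ G) := hG.fderiv_right (by simp)
    exact (hG'.comp (by fun_prop : ContDiff ℝ (⊤ : ℕ∞)
      fun (x : Fin (m + 1) → E n) (i : Fin m) => x i.castSucc)).clm_apply (by fun_prop)
  · beta_reduce
    rw [funext (hΦ q hq)]
    exact (((hG.differentiable (by simp)) _).hasFDerivAt.comp_hasDerivAt t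
      (hasDerivAt_jet hq m t)).deriv

protected theorem iteratedDeriv {Φ : (ℝ → E n) → ℝ → W} (hΦ : IsJetFunctional m Φ) (j : ℕ) :
    IsJetFunctional (m + j) fun q => iteratedDeriv j (Φ q) := by
  induction j with
  | zero => simpa using hΦ
  | succ j ih => simpa only [iteratedDeriv_succ, ← add_assoc] using ih.deriv

/-- The `j`-th total derivative of a function of the `m`-jet is affine in the derivative of order
`m + j`, with leading coefficient the last partial derivative. -/
theorem iteratedDeriv_comp_jet_sub {F : (Fin (m + 1) → E n) → W} (hF : ContDiff ℝ (⊤ : ℕ∞) F)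
    (j : ℕ) :
    IsJetFunctional (m + (j + 1)) fun q t =>
      iteratedDeriv (j + 1) (fun s => F (jet q m s)) t -
        (fderiv ℝ F (jet q m t) ∘L
          ContinuousLinearMap.single ℝ (fun _ : Fin (m + 1) => E n) (Fin.last m))
          (iteratedDeriv (m + (j + 1)) q t) := by
  have hF' : ContDiff ℝ (⊤ : ℕ∞) (fderiv ℝ F) := hF.fderiv_right (by simp)
  have hlead : IsJetFunctional (m + 1) fun q t => fderiv ℝ F (jet q m t) ∘L
      ContinuousLinearMap.single ℝ (fun _ : Fin (m + 1) => E n) (Fin.last m) :=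
    ⟨fun x => fderiv ℝ F x ∘L
      ContinuousLinearMap.single ℝ (fun _ : Fin (m + 1) => E n) (Fin.last m),
      hF'.clm_comp contDiff_const, fun _ _ _ => rfl⟩
  induction j with
  | zero =>
    refine ⟨fun x => fderiv ℝ F x (Fin.snoc (fun i => x i.succ) 0),
      hF'.clm_apply (contDiff_pi.2 fun i => ?_), fun q hq t => ?_⟩
    · refine Fin.lastCases ?_ (fun i => ?_) i
      · simpa using contDiff_const
      · simpa using contDiff_apply ℝ (E n) i.succ
    · have hd : HasDerivAt (fun s => F (jet q m s)) _ t :=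
        ((hF.differentiable (by simp)) _).hasFDerivAt.comp_hasDerivAt t
          (hasDerivAt_jet hq (m + 1) t)
      simp only [zero_add, iteratedDeriv_one]
      rw [hd.deriv, ContinuousLinearMap.comp_apply, sub_eq_iff_eq_add]
      change _ = fderiv ℝ F (jet q m t) _ + _
      rw [← map_add]
      refine congrArg (fderiv ℝ F (jet q m t)) (funext fun i => ?_)
      refine Fin.lastCases ?_ (fun i => ?_) i
      · simp
      · simp
  | succ j ih =>
    have htop : IsJetFunctional (m + (j + 1) + 1) fun (q : ℝ → E n) t =>
        iteratedDeriv (m + (j + 1)) q t := iteratedDeriv_self (Nat.lt_succ_self _)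
    refine (ih.deriv.add ((hlead.deriv.mono (by omega)).clm_apply htop)).congr fun q hq t => ?_
    have hA := (hlead.differentiable hq t).hasDerivAt
    have hAq := hA.clm_apply (hasDerivAt_iteratedDeriv_of_smooth hq (m + (j + 1)) t)
    have hsub := ((ih.differentiable hq t).hasDerivAt.add hAq).deriv
    simp only [Pi.add_def, sub_add_cancel] at hsub
    rw [iteratedDeriv_succ, hsub, ← add_assoc, ← add_assoc]
    exact add_sub_cancel_right _ _

end IsJetFunctional

theorem hasFDerivAt_comp_update {n k : ℕ} {W : Type*} [NormedAddCommGroup W] [NormedSpace ℝ W]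
    {F : (Fin (k + 1) → E n) → W} {x : Fin (k + 1) → E n} (hF : DifferentiableAt ℝ F x)
    (j : Fin (k + 1)) :
    HasFDerivAt (fun v => F (Function.update x j v))
      (fderiv ℝ F x ∘L ContinuousLinearMap.single ℝ (fun _ : Fin (k + 1) => E n) j) (x j) := by
  have hx : HasFDerivAt F (fderiv ℝ F x) (Function.update x j (x j)) := by
    simpa using hF.hasFDerivAt
  refine hx.comp (x j) ((hasFDerivAt_update x (x j)).congr_fderiv ?_)
  ext v i
  by_cases h : i = j
  · subst h; simp
  · simp [h]

theorem hessLast_eq {n k : ℕ} {L : (Fin (k + 1) → E n) → ℝ} (hL : ContDiff ℝ (⊤ : ℕ∞) L)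
    (x : Fin (k + 1) → E n) :
    hessLast L x = fderiv ℝ (pgrad L (Fin.last k)) x ∘L
      ContinuousLinearMap.single ℝ (fun _ : Fin (k + 1) => E n) (Fin.last k) :=
  (hasFDerivAt_comp_update ((contDiff_pgrad hL _).differentiable (by simp) x) _).fderiv

/-- **Linearity of the Euler–Lagrange expression in the highest derivative.**
There is a smooth map `R : (ℝⁿ)^{2k} → ℝⁿ` such that for every smooth curve `q` and every
`t`, `E_q t = (−1)^k H_L (j_k q t) (q^{(2k)} t) + R (j_{2k−1} q t)`. -/
theorem EL_linear_in_highest_derivative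
    (n k : ℕ) (hn : 1 ≤ n) (hk : 1 ≤ k)
    (L : (Fin (k + 1) → E n) → ℝ) (hL : ContDiff ℝ (⊤ : ℕ∞) L) :
    ∃ R : (Fin (2 * k - 1 + 1) → E n) → E n, ContDiff ℝ (⊤ : ℕ∞) R ∧
      ∀ q : ℝ → E n, ContDiff ℝ (⊤ : ℕ∞) q → ∀ t : ℝ,
        EL L q t =
          (-1 : ℝ) ^ k • hessLast L (jet q k t) (iteratedDeriv (2 * k) q t) +
            R (jet q (2 * k - 1) t) := by
  obtain ⟨k, rfl⟩ : ∃ l, k = l + 1 := ⟨k - 1, by omega⟩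
  have hlow : ∀ j : Fin (k + 1), IsJetFunctional (2 * (k + 1) - 1 + 1) fun q t =>
      (-1 : ℝ) ^ (j : ℕ) •
        iteratedDeriv j (fun s => pgrad L j.castSucc (jet q (k + 1) s)) t := fun j =>
    ((IsJetFunctional.iteratedDeriv (m := k + 1 + 1) (Φ := fun q s =>
      pgrad L j.castSucc (jet q (k + 1) s))
      ⟨pgrad L j.castSucc, contDiff_pgrad hL _, fun _ _ _ => rfl⟩ j).mono
        (by omega)).const_smul _
  have htop := ((IsJetFunctional.iteratedDeriv_comp_jet_sub
    (contDiff_pgrad hL (Fin.last (k + 1))) k).mono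
      (m' := 2 * (k + 1) - 1 + 1) (by omega)).const_smul ((-1 : ℝ) ^ (k + 1))
  obtain ⟨R, hR, hRq⟩ := (IsJetFunctional.sum hlow).add htop
  refine ⟨R, hR, fun q hq t => ?_⟩
  have h := hRq q hq t
  beta_reduce at h
  rw [← hessLast_eq hL, ← two_mul, smul_sub, ← add_sub_assoc, sub_eq_iff_eq_add'] at h
  rw [EL, Fin.sum_univ_castSucc]
  exact h
end
end
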